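/- arXiv:1204.3647 — 2 statements merged into one kernel-verified Lean document; each statement's English description precedes it below -/
import Mathlib

section
/- Let a and b be real numbers with 0 < a < b such that b/a is irrational. Then the lengths of the Euclidean firings decay geometrically: for every i ∈ ℕ, l_{i+3} < (1/2)·l_i. -/
/-- The Euclidean-algorithm pair sequence: `(a_i, b_i)` with `a_0 = a`, `b_0 = b`,
`a_{i+1} = b_i - ⌊b_i / a_i⌋ * a_i`, and `b_{i+1} = a_i`. -/
noncomputable def euclidPair (a b : ℝ) : ℕ → ℝ × ℝ
  | 0 => (a, b)
  | i + 1 =>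
    let p := euclidPair a b i
    (p.2 - (⌊p.2 / p.1⌋ : ℝ) * p.1, p.1)

/-- The remainder sequence `a_i` of the Euclidean algorithm. -/
noncomputable def aSeq (a b : ℝ) (i : ℕ) : ℝ := (euclidPair a b i).1

/-- The sequence `b_i` of the Euclidean algorithm. -/
noncomputable def bSeq (a b : ℝ) (i : ℕ) : ℝ := (euclidPair a b i).2

/-- The quotient sequence `n_i = ⌊b_i / a_i⌋`. -/
noncomputable def nSeq (a b : ℝ) (i : ℕ) : ℤ := ⌊bSeq a b i / aSeq a b i⌋

/-- The firing-length sequence `l_i = n_i * a_i`. -/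
noncomputable def lSeq (a b : ℝ) (i : ℕ) : ℝ := (nSeq a b i : ℝ) * aSeq a b i

theorem lSeq_eq_sub (a b : ℝ) (i : ℕ) : lSeq a b i = bSeq a b i - aSeq a b (i + 1) := by
  simp only [lSeq, nSeq, aSeq, bSeq, euclidPair]
  ring

theorem euclid_remainder_pos_lt {a b : ℝ} (ha : 0 < a) (h : Irrational (b / a)) :
    0 < b - (⌊b / a⌋ : ℝ) * a ∧ b - (⌊b / a⌋ : ℝ) * a < a := by
  have hle : (⌊b / a⌋ : ℝ) < b / a :=
    lt_of_le_of_ne (Int.floor_le _) fun e => h.ne_int ⌊b / a⌋ e.symm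
  have hlt := Int.lt_floor_add_one (b / a)
  rw [lt_div_iff₀ ha] at hle
  rw [div_lt_iff₀ ha] at hlt
  constructor <;> linarith

theorem irrational_div_euclid_remainder {a b : ℝ} (ha : 0 < a) (h : Irrational (b / a)) :
    Irrational (a / (b - (⌊b / a⌋ : ℝ) * a)) := by
  have e : a / (b - (⌊b / a⌋ : ℝ) * a) = (b / a - (⌊b / a⌋ : ℝ))⁻¹ := by
    rw [← inv_div, sub_div, mul_div_cancel_right₀ _ ha.ne']
  rw [e]
  exact (h.sub_intCast _).inv

theorem euclidPair_invariant {a b : ℝ} (ha : 0 < a) (hab : a < b) (h : Irrational (b / a))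
    (i : ℕ) : 0 < aSeq a b i ∧ aSeq a b i < bSeq a b i ∧ Irrational (bSeq a b i / aSeq a b i) := by
  induction i with
  | zero => exact ⟨ha, hab, h⟩
  | succ i ih =>
    obtain ⟨hpos, -, hirr⟩ := ih
    have hrem := euclid_remainder_pos_lt hpos hirr
    exact ⟨hrem.1, hrem.2, irrational_div_euclid_remainder hpos hirr⟩

theorem aSeq_le_lSeq {a b : ℝ} (ha : 0 < a) (hab : a < b) (h : Irrational (b / a)) (i : ℕ) :
    aSeq a b i ≤ lSeq a b i := by
  obtain ⟨hpos, hlt, -⟩ := euclidPair_invariant ha hab h i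
  have hn : (1 : ℤ) ≤ nSeq a b i := by
    rw [nSeq, Int.le_floor, Int.cast_one, one_le_div hpos]
    exact hlt.le
  exact le_mul_of_one_le_left hpos.le (by exact_mod_cast hn)

theorem euclid_lengths_halve (a b : ℝ) (ha : 0 < a) (hab : a < b)
    (hirr : Irrational (b / a)) :
    ∀ i : ℕ, lSeq a b (i + 3) < (1 / 2) * lSeq a b i := by
  intro i
  have hpos := (euclidPair_invariant ha hab hirr (i + 4)).1
  have hlt : aSeq a b (i + 2) < aSeq a b (i + 1) :=
    (euclidPair_invariant ha hab hirr (i + 2)).2.1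
  have hl := lSeq_eq_sub a b (i + 3)
  have hl' := lSeq_eq_sub a b (i + 1)
  have hb : bSeq a b (i + 3) = aSeq a b (i + 2) := rfl
  have hb' : bSeq a b (i + 1) = aSeq a b i := rfl
  have h0 := aSeq_le_lSeq ha hab hirr i
  have h1 := aSeq_le_lSeq ha hab hirr (i + 1)
  linarith
end

section
/- Let a and b be real numbers with 0 < a < b such that b/a is irrational. Then every partial sum of the lengths of the Euclidean firings is bounded by 4b: for every N ∈ ℕ, Σ_{i=0}^{N−1} l_i ≤ 4·b. -/
theorem aSeq_succ (a b : ℝ) (i : ℕ) : aSeq a b (i + 1) = bSeq a b i - lSeq a b i := rfl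

theorem bSeq_succ (a b : ℝ) (i : ℕ) : bSeq a b (i + 1) = aSeq a b i := rfl

theorem lSeq_le_bSeq {a b : ℝ} {i : ℕ} (ha : 0 ≤ aSeq a b i) (hb : 0 ≤ bSeq a b i) :
    lSeq a b i ≤ bSeq a b i := by
  rcases ha.eq_or_lt with h | h
  · rwa [lSeq, ← h, mul_zero]
  · exact (le_div_iff₀ h).1 (Int.floor_le _)

theorem aSeq_nonneg_and_bSeq_nonneg {a b : ℝ} (ha : 0 ≤ a) (hb : 0 ≤ b) (i : ℕ) :
    0 ≤ aSeq a b i ∧ 0 ≤ bSeq a b i := by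
  induction i with
  | zero => exact ⟨ha, hb⟩
  | succ i ih =>
    rw [aSeq_succ, bSeq_succ]
    exact ⟨sub_nonneg.2 (lSeq_le_bSeq ih.1 ih.2), ih.1⟩

theorem sum_lSeq_add_aSeq_add_bSeq (a b : ℝ) (N : ℕ) :
    ∑ i ∈ Finset.range N, lSeq a b i + aSeq a b N + bSeq a b N = a + b := by
  induction N with
  | zero => simp [aSeq, bSeq, euclidPair]
  | succ N ih =>
    rw [Finset.sum_range_succ, aSeq_succ, bSeq_succ]
    linarith

theorem euclid_partial_sums_le (a b : ℝ) (ha : 0 < a) (hab : a < b)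
    (hirr : Irrational (b / a)) :
    ∀ N : ℕ, ∑ i ∈ Finset.range N, lSeq a b i ≤ 4 * b := by
  intro N
  obtain ⟨hA, hB⟩ := aSeq_nonneg_and_bSeq_nonneg ha.le (ha.trans hab).le N
  linarith [sum_lSeq_add_aSeq_add_bSeq a b N]
end
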